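/- For every real number t, with s = 1/2 + i t, one has ζ(1/2 + i t) = 0 if and only if Re( π^{−s/2} Γ(s/2) R(s) ) = 0, where R is Riemann's auxiliary function. That is, the zeros of the Riemann zeta function on the critical line are exactly the points of the critical line where the real part of π^{−s/2} Γ(s/2) R(s) vanishes. -/

import Mathlib

open MeasureTheory

/-- The straight line of slope 1 crossing the real axis at `1/2`,
parametrized from upper right to lower left. -/
noncomputable def rline (u : ℝ) : ℂ :=
  1 / 2 - Complex.exp (Real.pi * Complex.I / 4) * (u : ℂ)

/-- Riemann's auxiliary function
`R(s) = ∫_{0↙1} x^{-s} e^{πix²}/(e^{πix} − e^{-πix}) dx`, written out as an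
integral over the real parameter of the line `0↙1`. Here `z ^ (-s)` is the
principal power `exp (−s Log z)`. -/
noncomputable def RiemannR (s : ℂ) : ℂ :=
  -Complex.exp (Real.pi * Complex.I / 4) *
    ∫ u : ℝ, (rline u) ^ (-s) *
      Complex.exp (Real.pi * Complex.I * (rline u) ^ 2) /
      (Complex.exp (Real.pi * Complex.I * rline u) -
        Complex.exp (-(Real.pi * Complex.I * rline u)))

namespace RSaux
open Complex Filter Topology Set

noncomputable def om : ℂ := cexp (Real.pi * I / 4)
noncomputable def hh : ℝ := √2 / 4

lemma hh_pos : 0 < hh := by unfold hh; positivity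
lemma hh_sq : hh * hh = 1 / 8 := by
  unfold hh
  have : √2 * √2 = 2 := Real.mul_self_sqrt (by norm_num)
  nlinarith
lemma hh_lt : hh < 1 / 2 := by nlinarith [hh_sq, hh_pos]
lemma hh_gt : 1 / 3 < hh := by nlinarith [hh_sq, hh_pos]

lemma om_eq : om = 2 * hh + 2 * hh * I := by
  have : (Real.pi * I / 4 : ℂ) = ((Real.pi / 4 : ℝ) : ℂ) * I := by push_cast; ring
  unfold om
  rw [this, exp_mul_I, ← ofReal_cos, ← ofReal_sin, Real.cos_pi_div_four, Real.sin_pi_div_four]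
  unfold hh; push_cast; ring

lemma om_sq : om * om = I := by
  have h : ((hh * hh : ℝ) : ℂ) = 1 / 8 := by rw [hh_sq]; push_cast; ring
  push_cast at h
  rw [om_eq]; linear_combination (8 * I) * h + (4 * hh * hh) * I_sq

lemma om_ne : om ≠ 0 := exp_ne_zero _
lemma om_re : om.re = 2 * hh := by simp [om_eq]
lemma om_im : om.im = 2 * hh := by simp [om_eq]

lemma conj_om : (starRingEnd ℂ) om = -I * om := by
  rw [om_eq]; simp only [map_add, map_mul, conj_I, conj_ofReal, map_ofNat]; linear_combination (2 * hh : ℂ) * I_sq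

/-- the denominator in the rotated coordinate -/
noncomputable def D (z : ℂ) : ℂ := cexp (-(Real.pi * I * om * z)) - cexp (Real.pi * I * om * z)

lemma D_neg (z : ℂ) : D (-z) = - D z := by
  unfold D; rw [mul_neg]; ring_nf

lemma D_diff : Differentiable ℂ D := by unfold D; fun_prop
lemma D_cont : Continuous D := D_diff.continuous

lemma D_ge (x y : ℝ) : 2 * |Real.sinh (2 * hh * Real.pi * (x + y))| ≤ ‖D (x + y * I)‖ := by
  unfold D
  refine le_trans ?_ (abs_norm_sub_norm_le _ _)
  rw [norm_exp, norm_exp]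
  have e1 : (Real.pi * I * om * (x + y * I)).re = -(2 * hh * Real.pi * (x + y)) := by
    simp [om_re, om_im]; ring
  rw [neg_re, e1, neg_neg, Real.sinh_eq, abs_div, abs_two]
  linarith

lemma normSq_exp_sub (a b : ℝ) : ‖cexp (a + b * I) - cexp (-(a + b * I))‖ ^ 2
    = 4 * (Real.sinh a ^ 2 + Real.sin b ^ 2) := by
  rw [← Complex.normSq_eq_norm_sq, normSq_apply]
  have : (-(a + b * I) : ℂ) = ((-a : ℝ) : ℂ) + ((-b : ℝ) : ℂ) * I := by push_cast; ring
  rw [this]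
  simp only [sub_re, sub_im, exp_re, exp_im, add_re, add_im, ofReal_re, ofReal_im, mul_re, mul_im, I_re, I_im]
  simp
  rw [Real.sinh_eq]
  have h1 := Real.sin_sq_add_cos_sq b
  have h2 : Real.exp a * Real.exp (-a) = 1 := by rw [← Real.exp_add]; simp
  have h3 : Real.cos b ^ 2 = 1 - Real.sin b ^ 2 := by linarith
  ring_nf
  rw [h3]
  linear_combination (4 * Real.sin b^2) * h2 

lemma D_ge_two (x y : ℝ) (hy : y = hh ∨ y = -hh) : 2 ≤ ‖D (x + y * I)‖ := by
  set a := 2 * hh * Real.pi * (x + y) with ha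
  have key : ‖D (x + y * I)‖ ^ 2 = 4 * (Real.sinh a ^ 2 + Real.cos a ^ 2) := by
    have e : D (x + y * I) = cexp (a + ((-(2 * hh * Real.pi * (x - y)) : ℝ) : ℂ) * I)
        - cexp (-(a + ((-(2 * hh * Real.pi * (x - y)) : ℝ) : ℂ) * I)) := by
      unfold D
      have : -(Real.pi * I * om * (x + y * I)) = (a + ((-(2 * hh * Real.pi * (x - y)) : ℝ) : ℂ) * I) := by
        rw [om_eq, ha]; push_cast; ring_nf; simp only [I_sq, show I ^ 3 = -I by rw [pow_succ, I_sq]; ring]; ring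
      rw [← this, neg_neg]
    rw [e, normSq_exp_sub]
    congr 2
    have h8 := hh_sq
    rcases hy with h | h
    · have : -(2 * hh * Real.pi * (x - y)) = Real.pi / 2 - a := by
        rw [ha, h]; linear_combination (4 * Real.pi) * h8
      rw [this, Real.sin_pi_div_two_sub]
    · have : -(2 * hh * Real.pi * (x - y)) = -(a + Real.pi / 2)  := by
        rw [ha, h]; linear_combination (-4 * Real.pi) * h8
      rw [this, Real.sin_neg, Real.sin_add_pi_div_two]; ring
  have s1 : a ^ 2 ≤ Real.sinh a ^ 2 := by
    rw [sq_le_sq]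
    rcases le_total 0 a with h | h
    · rw [abs_of_nonneg h, abs_of_nonneg (Real.sinh_nonneg_iff.2 h)]; exact Real.self_le_sinh_iff.2 h
    · rw [abs_of_nonpos h, abs_of_nonpos (Real.sinh_nonpos_iff.2 h)]; linarith [Real.sinh_le_self_iff.2 h]
  have s2 : Real.sin a ^ 2 ≤ a ^ 2 := by
    rw [sq_le_sq]; exact Real.abs_sin_le_abs
  have := Real.sin_sq_add_cos_sq a
  nlinarith [norm_nonneg (D (x + y * I))]

lemma D_ge_far (x y : ℝ) (hy : |y| ≤ hh) (hx : 1 ≤ |x|) : 1 ≤ ‖D (x + y * I)‖ := by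
  refine le_trans ?_ (D_ge x y)
  have h1 : 1 / 2 ≤ |x + y| := by
    have := abs_sub_abs_le_abs_sub x (-y)
    rw [abs_neg, sub_neg_eq_add] at this
    linarith [hh_lt]
  have h2 : 1 / 2 ≤ |2 * hh * Real.pi * (x + y)| := by
    rw [abs_mul, abs_of_pos (by have := hh_pos; positivity)]
    have : 1 ≤ 2 * hh * Real.pi := by nlinarith [hh_gt, Real.pi_gt_three]
    nlinarith
  have : 1 / 2 ≤ |Real.sinh (2 * hh * Real.pi * (x + y))| := by
    rw [Real.abs_sinh]
    exact h2.trans (Real.self_le_sinh_iff.2 (abs_nonneg _))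
  linarith

/-- zeros of D in the strip -/
lemma D_ne (z : ℂ) (hz : |z.im| ≤ hh) (h0 : z ≠ 0) : D z ≠ 0 := by
  intro h
  unfold D at h
  rw [sub_eq_zero, exp_eq_exp_iff_exists_int] at h
  obtain ⟨n, hn⟩ := h
  have hpi : (Real.pi : ℂ) ≠ 0 := by exact_mod_cast Real.pi_ne_zero
  have h1 : om * z = -n := by
    have : (2 * Real.pi * I) * (om * z + n) = 0 := by linear_combination -hn
    rcases mul_eq_zero.1 this with h | h
    · simp [hpi] at h
    · linear_combination h
  have h2 : z = I * om * n := by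
    have : I * z = -om * n := by rw [← om_sq]; linear_combination om * h1
    linear_combination -I * this + z * I_sq 
  have h3 : z.im = 2 * hh * n := by
    rw [h2]; simp [om_re, om_im]
  rw [h3] at hz
  have hn0 : n ≠ 0 := by rintro rfl; simp at h2; exact h0 h2
  have : (1 : ℝ) ≤ |(n : ℝ)| := by exact_mod_cast Int.one_le_abs hn0
  rw [abs_mul, abs_of_pos (by linarith [hh_pos])] at hz
  nlinarith [hh_pos]

lemma gint (c : ℝ) : Integrable (fun u : ℝ => Real.exp (-Real.pi * u ^ 2 + c * |u|)) := by
  have h : ∀ c : ℝ, Integrable (fun u : ℝ => Real.exp (-Real.pi * u ^ 2 + c * u)) := by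
    intro c
    have := (integrable_cexp_quadratic (b := Real.pi) (by simpa using Real.pi_pos) c 0).norm
    refine this.congr (ae_of_all _ fun u => ?_)
    simp only [norm_exp]
    congr 1
    have : (-(Real.pi:ℂ) * u ^ 2 + c * u + 0) = ((-Real.pi * u ^ 2 + c * u : ℝ) : ℂ) := by push_cast; ring
    rw [this, ofReal_re]
  refine ((h c).add (h (-c))).mono' (by fun_prop) (ae_of_all _ fun u => ?_)
  rw [Real.norm_eq_abs, abs_of_pos (Real.exp_pos _)]
  simp only [Pi.add_apply]
  rcases abs_cases u with ⟨h, _⟩ | ⟨h, _⟩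
  · rw [h]; linarith [Real.exp_pos (-Real.pi * u ^ 2 + -c * u)]
  · rw [h]
    have : c * -u = -c * u := by ring
    rw [this]; linarith [Real.exp_pos (-Real.pi * u ^ 2 + c * u)]

lemma gtend (c : ℝ) : Tendsto (fun u : ℝ => Real.exp (-Real.pi * u ^ 2 + c * |u|)) atTop (𝓝 0) := by
  apply Real.tendsto_exp_atBot.comp
  have : Tendsto (fun u : ℝ => u * (-Real.pi * u + c)) atTop atBot := by
    apply Tendsto.atTop_mul_atBot₀ tendsto_id
    apply tendsto_atBot_add_const_right
    exact tendsto_id.const_mul_atTop_of_neg (by linarith [Real.pi_pos])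
  refine this.congr' ?_
  filter_upwards [eventually_ge_atTop 0] with u hu
  rw [abs_of_nonneg hu]; ring

lemma norm_gauss (x y : ℝ) : ‖cexp (-Real.pi * (x + y * I) ^ 2)‖ = Real.exp (-Real.pi * x ^ 2 + Real.pi * y ^ 2) := by
  rw [norm_exp]; congr 1
  have : (-Real.pi * (x + y * I) ^ 2 : ℂ) = ((-Real.pi * x ^ 2 + Real.pi * y ^ 2 : ℝ) : ℂ) + ((-2 * Real.pi * x * y : ℝ) : ℂ) * I := by
    push_cast; ring_nf; rw [I_sq]; ring
  rw [this, add_re, ofReal_re, re_ofReal_mul, I_re]; ring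

/-- strip shift -/
lemma strip (f : ℂ → ℂ) (a b : ℝ) (hab : a ≤ b)
    (hc : ContinuousOn f {z | z.im ∈ Icc a b})
    (hd : DifferentiableOn ℂ f {z | z.im ∈ Ioo a b})
    (B : ℝ → ℝ) (hB : Tendsto B atTop (𝓝 0))
    (hf : ∀ x y : ℝ, y ∈ Icc a b → 1 ≤ |x| → ‖f (x + y * I)‖ ≤ B |x|) :
    Tendsto (fun T : ℝ => (∫ x in (-T)..T, f (x + a * I)) - ∫ x in (-T)..T, f (x + b * I)) atTop (𝓝 0) := by
  have key : ∀ T : ℝ, 1 ≤ T → ‖(∫ x in (-T)..T, f (x + a * I)) - ∫ x in (-T)..T, f (x + b * I)‖ ≤ 2 * (B T * |b - a|) := by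
    intro T hT
    have := Complex.integral_boundary_rect_eq_zero_of_continuousOn_of_differentiableOn f
      (((-T : ℝ) : ℂ) + a * I) ((T : ℂ) + b * I) ?_ ?_
    · simp only [add_re, add_im, ofReal_re, ofReal_im, mul_re, mul_im, I_re, I_im, mul_zero, mul_one, zero_add, add_zero, sub_zero] at this
      have e : (∫ x in (-T)..T, f (x + a * I)) - ∫ x in (-T)..T, f (x + b * I) =
         I • (∫ (y : ℝ) in a..b, f (((-T : ℝ) : ℂ) + ↑y * I)) - I • (∫ (y : ℝ) in a..b, f ((T : ℂ) + ↑y * I)) := by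
        linear_combination this
      rw [e]
      refine (norm_sub_le _ _).trans ?_
      rw [norm_smul, norm_smul, norm_I, one_mul, one_mul, two_mul]
      have hTabs : |T| = T := abs_of_nonneg (by linarith)
      refine add_le_add ?_ ?_
      · refine intervalIntegral.norm_integral_le_of_norm_le_const fun y hy => ?_
        rw [uIoc_of_le hab] at hy
        have := hf (-T) y ⟨hy.1.le, hy.2⟩ (by rw [abs_neg, hTabs]; exact hT)
        rwa [abs_neg, hTabs] at this
      · refine intervalIntegral.norm_integral_le_of_norm_le_const fun y hy => ?_
        rw [uIoc_of_le hab] at hy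
        have := hf (T) y ⟨hy.1.le, hy.2⟩ (by rw [hTabs]; exact hT)
        rwa [hTabs] at this
    · refine hc.mono ?_
      intro z hz
      have := hz.2
      simpa [uIcc_of_le hab] using this
    · refine hd.mono ?_
      intro z hz
      have := hz.2
      simpa [hab] using this
  refine squeeze_zero_norm' (a := fun T => 2 * (B T * |b - a|)) ?_ ?_
  · filter_upwards [eventually_ge_atTop 1] with T hT using key T hT
  · simpa using (hB.mul_const |b - a|).const_mul 2

noncomputable def W (s z : ℂ) : ℂ := (-I * z) ^ (-s) * (cexp (-Real.pi * z ^ 2) / D z)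

lemma R_eq (s : ℂ) : RiemannR s = -om * cexp (Real.pi * I / 4 * s) * ∫ u : ℝ, W s (u + hh * I) := by
  unfold RiemannR
  rw [show cexp (Real.pi * I / 4) = om from rfl, mul_assoc]
  congr 1
  rw [← integral_const_mul,
    ← integral_sub_right_eq_self (fun u : ℝ => cexp (Real.pi * I / 4 * s) * W s (u + hh * I)) hh]
  refine integral_congr_ae (ae_of_all _ fun u => ?_)
  dsimp only
  have hx : rline u = -om * ((u - hh : ℝ) + hh * I) := by
    unfold rline
    rw [show cexp (Real.pi * I / 4) = om from rfl, om_eq]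
    have h : ((hh * hh : ℝ) : ℂ) = 1 / 8 := by rw [hh_sq]; push_cast; ring
    push_cast at h ⊢
    linear_combination (-4 : ℂ) * h + (2 * hh * hh : ℂ) * I_sq
  set z : ℂ := ((u - hh : ℝ) + hh * I) with hz
  have hzim : z.im = hh := by simp [hz]
  have hre : 0 < (-I * z).re := by simp [hzim, hh_pos]
  have hzne : -I * z ≠ 0 := by intro h; rw [h] at hre; simp at hre
  have hx2 : rline u = cexp (((-(Real.pi / 4) : ℝ) : ℂ) * I) * (-I * z) := by
    have : cexp (((-(Real.pi / 4) : ℝ) : ℂ) * I) = -I * om := by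
      rw [← conj_om]; unfold om; rw [← exp_conj]; congr 1; simp only [map_div₀, map_mul, conj_I, conj_ofReal, map_ofNat]; push_cast; ring
    rw [this, hx]; linear_combination (-om * z) * I_sq
  have hpow : (rline u) ^ (-s) = cexp (Real.pi * I / 4 * s) * (-I * z) ^ (-s) := by
    have harg : (cexp (((-(Real.pi / 4) : ℝ) : ℂ) * I)).arg = -(Real.pi / 4) := by
      rw [arg_exp_mul_I, toIocMod_eq_self]
      constructor <;> linarith [Real.pi_pos]
    have h2 : |(-I * z).arg| < Real.pi / 2 := abs_arg_lt_pi_div_two_iff.2 (Or.inl hre)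
    rw [abs_lt] at h2
    have hlog : log (rline u) = ((-(Real.pi / 4) : ℝ) : ℂ) * I + log (-I * z) := by
      rw [hx2, log_mul (exp_ne_zero _) hzne, log_exp]
      · simp; linarith [Real.pi_pos]
      · simp; linarith [Real.pi_pos]
      · rw [harg]; constructor <;> linarith [Real.pi_pos]
    have hne : rline u ≠ 0 := by rw [hx2]; exact mul_ne_zero (exp_ne_zero _) hzne
    rw [cpow_def_of_ne_zero hne, cpow_def_of_ne_zero hzne, ← exp_add, hlog]
    congr 1; push_cast; ring
  rw [hpow]
  unfold W D
  have e1 : Real.pi * I * rline u ^ 2 = -Real.pi * z ^ 2 := by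
    rw [hx]; linear_combination (Real.pi * I * z ^ 2) * om_sq + Real.pi * z ^ 2 * I_sq
  have e2 : Real.pi * I * rline u = -(Real.pi * I * om * z) := by rw [hx]; ring
  rw [e1, e2, neg_neg]; ring

lemma mint {σ ρ : ℝ} (hσ : 0 < σ) (hρ : 0 < ρ) :
    IntegrableOn (fun t : ℝ => t ^ (σ - 1) * Real.exp (-ρ * t)) (Ioi 0) := by
  simpa using integrableOn_rpow_mul_exp_neg_mul_rpow (p := 1) (s := σ - 1) (b := ρ) (by linarith) one_pos hρ

lemma meas_cpow (a : ℂ) : AEStronglyMeasurable (fun t : ℝ => (t : ℂ) ^ a) (volume.restrict (Ioi 0)) := by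
  refine ContinuousOn.aestronglyMeasurable ?_ measurableSet_Ioi
  intro t ht
  refine ContinuousAt.continuousWithinAt ?_
  exact continuousAt_ofReal_cpow_const _ _ (Or.inr (ne_of_gt ht))

lemma mintC {a r : ℂ} (ha : 0 < a.re) (hr : 0 < r.re) :
    IntegrableOn (fun t : ℝ => (t : ℂ) ^ (a - 1) * cexp (-(r * t))) (Ioi 0) := by
  refine (mint ha hr).mono' ((meas_cpow _).mul (by fun_prop)) ?_
  filter_upwards [ae_restrict_mem measurableSet_Ioi] with t ht
  rw [norm_mul, norm_cpow_eq_rpow_re_of_pos ht, norm_exp]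
  simp

lemma gamC {a r : ℂ} (ha : 0 < a.re) (hr : 0 < r.re) :
    ∫ t in Ioi (0 : ℝ), (t : ℂ) ^ (a - 1) * cexp (-(r * t)) = r ^ (-a) * Gamma a := by
  have hopen : IsOpen {r : ℂ | 0 < r.re} := isOpen_lt continuous_const continuous_re
  have h1 : DifferentiableOn ℂ (fun r : ℂ => ∫ t in Ioi (0 : ℝ), (t : ℂ) ^ (a - 1) * cexp (-(r * t))) {r | 0 < r.re} := by
    intro r0 hr0
    have hr0' : 0 < r0.re := hr0
    refine DifferentiableAt.differentiableWithinAt ?_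
    refine (hasDerivAt_integral_of_dominated_loc_of_deriv_le (μ := volume.restrict (Ioi 0))
      (F := fun (r : ℂ) (t : ℝ) => (t : ℂ) ^ (a - 1) * cexp (-(r * t)))
      (F' := fun (r : ℂ) (t : ℝ) => (t : ℂ) ^ (a - 1) * (cexp (-(r * t)) * (-t)))
      (bound := fun t : ℝ => t ^ ((a.re + 1) - 1) * Real.exp (-(r0.re / 2) * t)) (s := {r : ℂ | r0.re / 2 < r.re})
      ?_ ?_ (mintC ha hr0) ?_ ?_ (mint (by linarith) (by linarith)) ?_).2.differentiableAt
    · exact (isOpen_lt continuous_const continuous_re).mem_nhds (by simp; linarith)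
    · exact Eventually.of_forall fun r => (meas_cpow _).mul (by fun_prop)
    · exact (meas_cpow _).mul (by fun_prop)
    · filter_upwards [ae_restrict_mem measurableSet_Ioi] with t ht r hr
      have ht' : 0 < t := ht
      have hr' : r0.re / 2 < r.re := hr
      rw [norm_mul, norm_cpow_eq_rpow_re_of_pos ht, norm_mul, norm_exp, norm_neg, norm_real, Real.norm_eq_abs, abs_of_pos ht']
      have e : t ^ (a.re + 1 - 1) = t ^ (a.re - 1) * t := by
        rw [← Real.rpow_add_one ht'.ne']; ring_nf
      rw [e]
      simp only [neg_re, mul_re, ofReal_re, ofReal_im, mul_zero, sub_zero, sub_re, one_re]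
      have : Real.exp (-(r.re * t)) ≤ Real.exp (-(r0.re / 2) * t) := Real.exp_le_exp.2 (by nlinarith)
      calc _ = (t ^ (a.re - 1) * t) * Real.exp (-(r.re * t)) := by ring
        _ ≤ _ := by gcongr
    · refine ae_of_all _ fun t r _ => ?_
      refine HasDerivAt.const_mul _ ?_
      have : HasDerivAt (fun r : ℂ => -(r * t)) (-t) r := by
        exact (hasDerivAt_mul_const (t : ℂ)).neg
      exact this.cexp
  have h2 : DifferentiableOn ℂ (fun r : ℂ => r ^ (-a) * Gamma a) {r | 0 < r.re} := by
    intro r hr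
    refine DifferentiableAt.differentiableWithinAt ?_
    refine DifferentiableAt.mul_const ?_ _
    exact differentiableAt_id.cpow_const (Or.inl hr)
  have hconv : Convex ℝ {r : ℂ | 0 < r.re} := convex_halfSpace_re_gt 0
  refine (h1.analyticOnNhd hopen).eqOn_of_preconnected_of_frequently_eq (h2.analyticOnNhd hopen) hconv.isPreconnected
    (z₀ := 1) (by simp) ?_ hr
  have : Tendsto (fun x : ℝ => (x : ℂ)) (𝓝[>] 1) (𝓝[≠] 1) := by
    refine tendsto_nhdsWithin_iff.2 ⟨?_, ?_⟩
    · have : Tendsto (fun x : ℝ => (x : ℂ)) (𝓝 1) (𝓝 ((1 : ℝ) : ℂ)) := continuous_ofReal.tendsto _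
      rw [ofReal_one] at this
      exact this.mono_left nhdsWithin_le_nhds
    · filter_upwards [self_mem_nhdsWithin] with x hx
      simp only [mem_compl_iff, mem_singleton_iff]
      intro h
      have h' : x = 1 := by exact_mod_cast h
      exact (ne_of_gt hx) h'
  refine this.frequently (Eventually.frequently ?_)
  filter_upwards [self_mem_nhdsWithin] with x hx
  have hx0 : 0 < x := lt_trans one_pos hx
  rw [integral_cpow_mul_exp_neg_mul_Ioi ha hx0]
  congr 1
  rw [one_div, inv_cpow, cpow_neg]
  rw [arg_ofReal_of_nonneg hx0.le]
  exact Real.pi_ne_zero.symm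

noncomputable def P (z : ℂ) : ℂ := cexp (-Real.pi * z ^ 2) / D z

lemma P_meas (y : ℝ) : Measurable fun u : ℝ => P (u + y * I) := by
  unfold P
  have := D_cont.measurable
  fun_prop

lemma line_ne (y : ℝ) (hy : y = hh ∨ y = -hh) (u : ℝ) : D (u + y * I) ≠ 0 := by
  have := D_ge_two u y hy
  intro h; rw [h] at this; simp at this; linarith

lemma P_le (y : ℝ) (hy : y = hh ∨ y = -hh) (u : ℝ) :
    ‖P (u + y * I)‖ ≤ Real.exp (Real.pi) * Real.exp (-Real.pi * u ^ 2 + 0 * |u|) := by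
  unfold P
  rw [norm_div, norm_gauss, ← Real.exp_add]
  have h2 := D_ge_two u y hy
  refine (div_le_self (Real.exp_pos _).le (by linarith)).trans (Real.exp_le_exp.2 ?_)
  have : y ^ 2 ≤ 1 := by
    have := hh_sq
    rcases hy with h | h <;> rw [h] <;> nlinarith
  nlinarith [Real.pi_pos]

lemma P_int (y : ℝ) (hy : y = hh ∨ y = -hh) : Integrable fun u : ℝ => P (u + y * I) :=
  ((gint 0).const_mul (Real.exp Real.pi)).mono' (P_meas y).aestronglyMeasurable (ae_of_all _ (P_le y hy))

lemma norm_eIz (u y v : ℝ) : ‖cexp (I * (u + y * I) * v)‖ = Real.exp (-y * v) := by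
  rw [norm_exp]; congr 1; simp

lemma PP_int (y v : ℝ) (hy : y = hh ∨ y = -hh) :
    Integrable fun u : ℝ => cexp (I * (u + y * I) * v) * P (u + y * I) := by
  refine (P_int y hy).bdd_mul (c := Real.exp (-y * v)) (by fun_prop) (ae_of_all _ fun u => ?_)
  rw [norm_eIz]

noncomputable def Psi (y v : ℝ) : ℂ := ∫ u : ℝ, cexp (I * (u + y * I) * v) * P (u + y * I)

lemma GR {s : ℂ} (hs : 0 < s.re) : Gamma s * RiemannR s =
    -om * cexp (Real.pi * I / 4 * s) * ∫ v in Ioi (0 : ℝ), (v : ℂ) ^ (s - 1) * Psi hh v := by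
  rw [R_eq, mul_left_comm]
  congr 1
  rw [← integral_const_mul]
  have h1 : ∀ u : ℝ, Gamma s * W s (u + hh * I) =
      ∫ v in Ioi (0 : ℝ), P (u + hh * I) * ((v : ℂ) ^ (s - 1) * cexp (I * (u + hh * I) * v)) := by
    intro u
    have := gamC (a := s) (r := -I * (u + hh * I)) hs (by simp [hh_pos])
    unfold W
    rw [integral_const_mul]
    have e : ∀ v : ℝ, I * (u + hh * I) * v = -(-I * (u + hh * I) * v) := fun v => by ring
    simp_rw [e]
    rw [this]; unfold P; ring
  simp_rw [h1]
  rw [integral_integral_swap]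
  · refine integral_congr_ae (ae_of_all _ fun v => ?_)
    dsimp only
    unfold Psi
    rw [← integral_const_mul]
    congr 1; ext u; ring
  · have hp := (P_int hh (Or.inl rfl)).norm.mul_prod (mint hs hh_pos)
    refine hp.mono' ?_ ?_
    · unfold Function.uncurry
      refine AEStronglyMeasurable.mul ?_ (AEStronglyMeasurable.mul ?_ ?_)
      · exact ((P_meas hh).comp measurable_fst).aestronglyMeasurable
      · exact (meas_cpow (s - 1)).comp_snd
      · exact Continuous.aestronglyMeasurable (by fun_prop)
    · have : ∀ᵐ p : ℝ × ℝ ∂((volume : Measure ℝ).prod (volume.restrict (Ioi (0 : ℝ)))), 0 < p.2 := by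
        have := (Measure.quasiMeasurePreserving_snd (μ := (volume : Measure ℝ)) (ν := volume.restrict (Ioi (0 : ℝ)))).ae
          (ae_restrict_mem measurableSet_Ioi)
        exact this
      filter_upwards [this] with p hp
      simp only [Function.uncurry]
      rw [norm_mul, norm_mul, norm_eIz, norm_cpow_eq_rpow_re_of_pos hp]
      simp

lemma Psi_shift (v : ℝ) : Psi (-hh) v =
    cexp (om * v) * (Psi hh v - (-I * om) * cexp (-v ^ 2 / (4 * Real.pi) - om * v / 2)) := by
  have hpi : (Real.pi : ℂ) ≠ 0 := by exact_mod_cast Real.pi_ne_zero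
  have hgauss : ∫ u : ℝ, cexp (-Real.pi * (u : ℂ) ^ 2 + (-2 * Real.pi * hh * I + (I * v + Real.pi * I * om)) * u
      + (Real.pi * hh ^ 2 + I * hh * (I * v + Real.pi * I * om))) =
      (-I * om) * cexp (-v ^ 2 / (4 * Real.pi) - om * v / 2) := by
    rw [integral_cexp_quadratic (by simp [Real.pi_pos])]
    rw [neg_neg, div_self hpi, one_cpow, one_mul]
    have : -I * om = cexp (-(Real.pi * I / 4)) := by
      rw [← conj_om]; unfold om; rw [← exp_conj]; congr 1; simp only [map_div₀, map_mul, conj_I, conj_ofReal, map_ofNat]; ring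
    rw [this, ← exp_add]
    congr 1
    field_simp
    linear_combination (8 * Real.pi ^ 2 * hh ^ 2 + (2 * v ^ 2 + 4 * Real.pi * om * v)) * I_sq + 2 * Real.pi ^ 2 * (I ^ 2) * om_sq + 2 * Real.pi ^ 2 * I * I_sq
  rw [← hgauss]
  unfold Psi
  rw [← integral_add_right_eq_self _ (2 * hh), ← integral_sub, ← integral_const_mul]
  · refine integral_congr_ae (ae_of_all _ fun u => ?_)
    dsimp only
    set z : ℂ := u + hh * I with hz
    have hDz : D z ≠ 0 := line_ne hh (Or.inl rfl) u
    have e1 : ((u + 2 * hh : ℝ) : ℂ) + ((-hh : ℝ) : ℂ) * I = z + (-I * om) := by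
      rw [hz, om_eq]; push_cast; linear_combination (2 * hh : ℂ) * I_sq
    have e2 : D (z + -I * om) = - D z := by
      unfold D
      have : Real.pi * I * om * (z + -I * om) = Real.pi * I * om * z + Real.pi * I := by
        linear_combination (-Real.pi * I ^ 2) * om_sq - Real.pi * I * I_sq
      rw [this, neg_add, exp_add, exp_add, exp_neg (Real.pi * I), exp_pi_mul_I]
      ring
    have e3 : cexp (-Real.pi * (z + -I * om) ^ 2) = - (cexp (-Real.pi * z ^ 2) * cexp (2 * (Real.pi * I * om * z))) := by
      have : -Real.pi * (z + -I * om) ^ 2 = -Real.pi * z ^ 2 + 2 * (Real.pi * I * om * z) + Real.pi * I := by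
        linear_combination (-Real.pi * I ^ 2) * om_sq - Real.pi * I * I_sq
      rw [this, exp_add, exp_add, exp_pi_mul_I]; ring
    have e4 : cexp (I * (z + -I * om) * v) = cexp (om * v) * cexp (I * z * v) := by
      rw [← exp_add]; congr 1; linear_combination (-om * v) * I_sq
    have e5 : cexp (-Real.pi * (u : ℂ) ^ 2 + (-2 * Real.pi * hh * I + (I * v + Real.pi * I * om)) * u
      + (Real.pi * hh ^ 2 + I * hh * (I * v + Real.pi * I * om))) =
      cexp (I * z * v) * cexp (-Real.pi * z ^ 2) * cexp (Real.pi * I * om * z) := by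
      rw [← exp_add, ← exp_add]; congr 1; rw [hz]
      linear_combination (Real.pi * hh ^ 2 : ℂ) * I_sq
    rw [e1, e5]
    unfold P
    rw [e2, e3, e4]
    have e6 : D z = (cexp (Real.pi * I * om * z))⁻¹ - cexp (Real.pi * I * om * z) := by
      unfold D; rw [exp_neg]
    have e7 : cexp (2 * (Real.pi * I * om * z)) = cexp (Real.pi * I * om * z) ^ 2 := by
      rw [← exp_nat_mul]; norm_num
    rw [e7]
    have hX := exp_ne_zero (Real.pi * I * om * z)
    have e8 : D z * cexp (Real.pi * I * om * z) = 1 - cexp (Real.pi * I * om * z) ^ 2 := by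
      rw [e6]; field_simp
    rw [neg_div_neg_eq]
    have e9 : cexp (om * v) * cexp (I * z * v) * (cexp (-Real.pi * z ^ 2) * cexp (Real.pi * I * om * z) ^ 2 / D z)
       = cexp (om * v) * cexp (I * z * v) * cexp (-Real.pi * z ^ 2) * (1 - (1 - cexp (Real.pi * I * om * z) ^ 2)) / D z := by ring
    rw [e9, ← e8]
    field_simp
  · exact PP_int hh v (Or.inl rfl)
  · have := integrable_cexp_quadratic (b := Real.pi) (by simpa using Real.pi_pos) (-2 * Real.pi * hh * I + (I * v + Real.pi * I * om)) (Real.pi * hh ^ 2 + I * hh * (I * v + Real.pi * I * om))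
    exact this

lemma cauchy_int : Integrable (fun x : ℝ => 1 / ((x : ℂ) + ((-hh : ℝ) : ℂ) * I) - 1 / ((x : ℂ) + hh * I)) ∧
    ∫ x : ℝ, (1 / ((x : ℂ) + ((-hh : ℝ) : ℂ) * I) - 1 / ((x : ℂ) + hh * I)) = 2 * Real.pi * I := by
  have hp := hh_pos
  have e : (fun x : ℝ => 1 / ((x : ℂ) + ((-hh : ℝ) : ℂ) * I) - 1 / ((x : ℂ) + hh * I)) =
      fun x : ℝ => (2 * I / hh) * (((1 + (x / hh) ^ 2)⁻¹ : ℝ) : ℂ) := by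
    ext x
    have h1 : (x : ℂ) + ((-hh : ℝ) : ℂ) * I ≠ 0 := by
      intro h; have := congrArg im h; simp at this; exact hp.ne' this
    have h2 : (x : ℂ) + hh * I ≠ 0 := by
      intro h; have := congrArg im h; simp at this; exact hp.ne' this
    have h3 : (hh : ℂ) ≠ 0 := by exact_mod_cast hp.ne'
    have h4 : ((hh ^ 2 + x ^ 2 : ℝ) : ℂ) ≠ 0 := by
      have : 0 < hh ^ 2 + x ^ 2 := by positivity
      exact_mod_cast this.ne'
    have h5 : (1 + ((x : ℂ) / hh) ^ 2) ≠ 0 := by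
      have : 1 + ((x : ℂ) / hh) ^ 2 = ((hh ^ 2 + x ^ 2 : ℝ) : ℂ) / hh ^ 2 := by push_cast; field_simp
      rw [this]; exact div_ne_zero h4 (pow_ne_zero _ h3)
    have h6 : ((x : ℂ) + ((-hh : ℝ) : ℂ) * I) * ((x : ℂ) + hh * I) = hh ^ 2 * (1 + ((x : ℂ) / hh) ^ 2) := by
      push_cast; field_simp; linear_combination (-hh ^ 2 : ℂ) * I_sq
    rw [div_sub_div _ _ h1 h2, h6]
    push_cast
    field_simp
    ring
  rw [e]
  constructor
  · exact ((integrable_inv_one_add_sq.comp_div hp.ne').ofReal).const_mul _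
  · rw [integral_const_mul, integral_complex_ofReal, Measure.integral_comp_div (fun y : ℝ => (1 + y ^ 2)⁻¹) hh,
      integral_univ_inv_one_add_sq, abs_of_pos hp]
    have h3 : (hh : ℂ) ≠ 0 := by exact_mod_cast hp.ne'
    simp
    field_simp

lemma Psi_res (v : ℝ) : Psi (-hh) v - Psi hh v = -om⁻¹ := by
  have hp := hh_pos
  have hpi : (Real.pi : ℂ) ≠ 0 := by exact_mod_cast Real.pi_ne_zero
  set E := dslope D 0 with hE
  have hD0 : D 0 = 0 := by simp [D]
  have hE0 : E 0 = -2 * Real.pi * I * om := by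
    rw [hE, dslope_same]
    have : HasDerivAt D (cexp (-(Real.pi * I * om * 0)) * (-(Real.pi * I * om * 1)) - cexp (Real.pi * I * om * 0) * (Real.pi * I * om * 1)) 0 :=
      ((((hasDerivAt_id (0:ℂ)).const_mul (Real.pi * I * om)).neg).cexp).sub (((hasDerivAt_id (0:ℂ)).const_mul (Real.pi * I * om)).cexp)
    rw [this.deriv]; simp; ring
  have hEz : ∀ z, z ≠ 0 → D z = z * E z := by
    intro z hz
    rw [hE, dslope_of_ne _ hz, slope_def_field, hD0, sub_zero, sub_zero, mul_div_cancel₀ _ hz]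
  have hEd : Differentiable ℂ E := by
    rw [← differentiableOn_univ, hE, Complex.differentiableOn_dslope univ_mem]
    exact D_diff.differentiableOn
  have hEne : ∀ z : ℂ, |z.im| ≤ hh → E z ≠ 0 := by
    intro z hz
    by_cases h0 : z = 0
    · rw [h0, hE0]; simp [hpi, om_ne]
    · intro h
      exact D_ne z hz h0 (by rw [hEz z h0, h, mul_zero])
  set q : ℂ → ℂ := fun z => cexp (I * z * v) * cexp (-Real.pi * z ^ 2) / E z with hq
  set c : ℂ := q 0 with hc
  have hcv : c * (2 * Real.pi * I) = -om⁻¹ := by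
    rw [hc, hq]; simp only [hE0]; simp
    have := om_ne
    field_simp
    exact I_sq
  have hqd : ∀ z : ℂ, |z.im| ≤ hh → DifferentiableAt ℂ q z := by
    intro z hz
    exact DifferentiableAt.div (by fun_prop) (hEd z) (hEne z hz)
  have hn : {z : ℂ | z.im ∈ Ioo (-hh) hh} ∈ 𝓝 (0 : ℂ) := by
    refine (isOpen_Ioo.preimage continuous_im).mem_nhds ?_
    simp [hp]
  have hgc : ContinuousOn (dslope q 0) {z : ℂ | z.im ∈ Icc (-hh) hh} := by
    refine (continuousOn_dslope (mem_of_superset hn fun z (hz : z.im ∈ Ioo (-hh) hh) => Ioo_subset_Icc_self (a := -hh) (b := hh) hz)).2 ?_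
    exact ⟨fun z hz => (hqd z (abs_le.2 hz)).continuousAt.continuousWithinAt, hqd 0 (by simp [hp.le])⟩
  have hgd : DifferentiableOn ℂ (dslope q 0) {z : ℂ | z.im ∈ Ioo (-hh) hh} := by
    rw [Complex.differentiableOn_dslope hn]
    exact fun z hz => (hqd z (abs_le.2 (Ioo_subset_Icc_self hz))).differentiableWithinAt
  have hg : ∀ z : ℂ, z ≠ 0 → dslope q 0 z = cexp (I * z * v) * P z - c * (1 / z) := by
    intro z hz
    rw [dslope_of_ne _ hz, slope_def_field, ← hc, sub_zero, sub_div, mul_one_div, hq]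
    unfold P
    rw [hEz z hz]
    simp only [div_div, mul_div_assoc, mul_comm (E z) z]
  have hlim := strip (dslope q 0) (-hh) hh (by linarith) hgc hgd
    (fun t => Real.exp |v| * Real.exp Real.pi * Real.exp (-Real.pi * t ^ 2 + 0 * |t|) + ‖c‖ * t⁻¹) (by
      simpa using ((gtend 0).const_mul (Real.exp |v| * Real.exp Real.pi)).add (tendsto_inv_atTop_zero.const_mul ‖c‖)) (by
      intro x y hy hx
      have hx0 : x ≠ 0 := by rintro rfl; simp at hx; linarith
      have hz : (x : ℂ) + y * I ≠ 0 := by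
        intro h; have := congrArg re h; simp at this; exact hx0 this
      rw [hg _ hz]
      refine (norm_sub_le _ _).trans (add_le_add ?_ ?_)
      · have hy' := abs_le.2 hy
        have := D_ge_far x y hy' hx
        rw [norm_mul, norm_eIz, mul_assoc]
        refine mul_le_mul (Real.exp_le_exp.2 ?_) ?_ (norm_nonneg _) (Real.exp_pos _).le
        · refine (le_abs_self _).trans ?_
          rw [abs_mul, abs_neg]
          nlinarith [abs_nonneg v, hh_lt]
        · unfold P
          rw [norm_div, norm_gauss, ← Real.exp_add]
          refine (div_le_self (Real.exp_pos _).le this).trans (Real.exp_le_exp.2 ?_)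
          have : y ^ 2 ≤ 1 := by rw [← sq_abs]; nlinarith [abs_nonneg y, hh_lt]
          rw [sq_abs]
          nlinarith [Real.pi_pos]
      · rw [norm_mul, one_div, norm_inv]
        gcongr
        have := abs_re_le_norm ((x : ℂ) + y * I)
        simpa using this)
  have hne : ∀ (y : ℝ), (y = hh ∨ y = -hh) → ∀ x : ℝ, (x : ℂ) + y * I ≠ 0 := by
    intro y hy x h
    have := congrArg im h; simp at this
    rcases hy with h | h <;> linarith
  have i1 : Integrable (fun x : ℝ => cexp (I * (x + (-hh : ℝ) * I) * v) * P (x + (-hh : ℝ) * I)) := PP_int (-hh) v (Or.inr rfl)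
  have i2 := PP_int hh v (Or.inl rfl)
  have i3 := cauchy_int.1.const_mul c
  have hlim2 : Tendsto (fun T : ℝ => (∫ x in (-T)..T, dslope q 0 (x + ((-hh : ℝ) : ℂ) * I)) - ∫ x in (-T)..T, dslope q 0 (x + hh * I)) atTop
      (𝓝 (Psi (-hh) v - Psi hh v - c * (2 * Real.pi * I))) := by
    rw [← cauchy_int.2, ← integral_const_mul]
    unfold Psi
    rw [← integral_sub i1 i2]
    have i12 := integral_sub (i1.sub i2) i3
    simp only [Pi.sub_apply] at i12
    rw [← i12]
    refine (intervalIntegral_tendsto_integral ((i1.sub i2).sub i3) tendsto_neg_atTop_atBot tendsto_id).congr fun T => ?_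
    rw [← intervalIntegral.integral_sub]
    · refine intervalIntegral.integral_congr fun x _ => ?_
      simp only [hg _ (hne _ (Or.inr rfl) x), hg _ (hne _ (Or.inl rfl) x)]
      change cexp (I * (x + (-hh : ℝ) * I) * v) * P (x + (-hh : ℝ) * I) - cexp (I * (x + hh * I) * v) * P (x + hh * I)
        - c * (1 / (x + (-hh : ℝ) * I) - 1 / (x + hh * I)) = _
      ring
    · refine ContinuousOn.intervalIntegrable (hgc.comp (by fun_prop) fun x _ => ?_)
      simp [hp.le]
    · refine ContinuousOn.intervalIntegrable (hgc.comp (by fun_prop) fun x _ => ?_)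
      simp [hp.le]
  have := tendsto_nhds_unique hlim2 hlim
  rw [hcv] at this
  linear_combination this

lemma Y_ge {v : ℝ} (hv : 0 < v) : 2 * hh * v ≤ ‖cexp (om * v / 2) - cexp (-(om * v / 2))‖ := by
  have hp := hh_pos
  refine le_trans ?_ (norm_sub_norm_le _ _)
  rw [norm_exp, norm_exp]
  have e1 : (om * v / 2).re = hh * v := by
    have : om * v / 2 = ((v / 2 : ℝ) : ℂ) * om := by push_cast; ring
    rw [this, re_ofReal_mul, om_re]; ring
  rw [neg_re, e1]
  have := Real.self_le_sinh_iff.2 (show 0 ≤ hh * v by positivity)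
  rw [Real.sinh_eq] at this
  linarith

lemma Y_ne {v : ℝ} (hv : 0 < v) : cexp (om * v / 2) - cexp (-(om * v / 2)) ≠ 0 := by
  have := Y_ge hv
  have hp := hh_pos
  intro h; rw [h, norm_zero] at this
  have : 0 < 2 * hh * v := by positivity
  linarith

lemma X_eq (v : ℝ) : cexp (om * v) - 1 = cexp (om * v / 2) * (cexp (om * v / 2) - cexp (-(om * v / 2))) := by
  rw [mul_sub, ← exp_add, ← exp_add, add_neg_cancel, exp_zero, add_halves]

lemma X_ne {v : ℝ} (hv : 0 < v) : cexp (om * v) - 1 ≠ 0 := by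
  rw [X_eq]; exact mul_ne_zero (exp_ne_zero _) (Y_ne hv)

lemma Psi_eq {v : ℝ} (hv : 0 < v) : -om * Psi hh v = 1 / (cexp (om * v) - 1)
    - cexp (-v ^ 2 / (4 * Real.pi)) / (cexp (om * v / 2) - cexp (-(om * v / 2))) := by
  have h1 := Psi_shift v
  have h2 := Psi_res v
  have hw : om⁻¹ = -I * om := by
    rw [inv_eq_iff_eq_inv, eq_comm, inv_eq_iff_eq_inv]
    refine eq_inv_of_mul_eq_one_left ?_
    linear_combination (-I) * om_sq - I_sq
  have hXe := X_eq v
  have hX := X_ne hv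
  have hY := Y_ne hv
  have hYY : cexp (om * v / 2) * cexp (-(om * v / 2)) = 1 := by rw [← exp_add]; simp
  rw [h1, hw, exp_sub] at h2
  have h3 : Psi hh v * (cexp (om * v) - 1) = (-I * om) * (cexp (-v ^ 2 / (4 * Real.pi)) * cexp (om * v / 2) - 1) := by
    have h4 : cexp (om * v) = cexp (om * v / 2) * cexp (om * v / 2) := by rw [← exp_add]; ring_nf
    rw [h4] at h2 ⊢
    have := exp_ne_zero (om * v / 2)
    rw [neg_div] at h2 ⊢
    field_simp at h2
    linear_combination h2
  have h5 : 1 / (cexp (om * v) - 1)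
    - cexp (-v ^ 2 / (4 * Real.pi)) / (cexp (om * v / 2) - cexp (-(om * v / 2))) =
      (1 - cexp (-v ^ 2 / (4 * Real.pi)) * cexp (om * v / 2)) / (cexp (om * v) - 1) := by
    rw [hXe]
    have := exp_ne_zero (om * v / 2)
    field_simp
  rw [h5, eq_div_iff hX]
  linear_combination (-om) * h3 + (-I * (1 - cexp (-v ^ 2 / (4 * Real.pi)) * cexp (om * v / 2))) * om_sq - (1 - cexp (-v ^ 2 / (4 * Real.pi)) * cexp (om * v / 2)) * I_sq

lemma meas_inv (f : ℝ → ℂ) (hf : Continuous f) (s : ℂ) (g : ℝ → ℂ) (hg : Continuous g):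
    AEStronglyMeasurable (fun v : ℝ => (v : ℂ) ^ (s - 1) * (g v / f v)) (volume.restrict (Ioi 0)) := by
  refine (meas_cpow _).mul ?_
  have := hf.measurable
  have := hg.measurable
  exact Measurable.aestronglyMeasurable (by fun_prop)

lemma int1 {s : ℂ} (hs : 1 < s.re) :
    IntegrableOn (fun v : ℝ => (v : ℂ) ^ (s - 1) * (1 / (cexp (om * v) - 1))) (Ioi 0) := by
  have hp := hh_pos
  refine ((mint (σ := s.re - 1) (ρ := hh) (by linarith) hp).const_mul (1 / (2 * hh))).mono'
    (meas_inv _ (by fun_prop) _ _ (by fun_prop)) ?_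
  filter_upwards [ae_restrict_mem measurableSet_Ioi] with v hv
  have hv' : 0 < v := hv
  rw [norm_mul, norm_cpow_eq_rpow_re_of_pos hv, X_eq, norm_div, norm_one, norm_mul, norm_exp]
  have e1 : (om * v / 2).re = hh * v := by
    have : om * v / 2 = ((v / 2 : ℝ) : ℂ) * om := by push_cast; ring
    rw [this, re_ofReal_mul, om_re]; ring
  rw [e1]
  have e : v ^ ((s - 1).re) = v ^ (s.re - 1 - 1) * v := by
    rw [← Real.rpow_add_one hv'.ne']; simp
  rw [e]
  have hY := Y_ge hv'
  have e2 : Real.exp (-hh * v) = (Real.exp (hh * v))⁻¹ := by rw [← Real.exp_neg]; ring_nf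
  rw [e2]
  calc _ ≤ v ^ (s.re - 1 - 1) * v * (1 / (Real.exp (hh * v) * (2 * hh * v))) := by
        gcongr
    _ = _ := by field_simp

lemma int2 {s : ℂ} (hs : 1 < s.re) :
    IntegrableOn (fun v : ℝ => (v : ℂ) ^ (s - 1) * (cexp (-v ^ 2 / (4 * Real.pi)) / (cexp (om * v / 2) - cexp (-(om * v / 2))))) (Ioi 0) := by
  have hp := hh_pos
  refine ((mint (σ := s.re - 1) (ρ := 1) (by linarith) one_pos).const_mul (Real.exp Real.pi / (2 * hh))).mono'
    (meas_inv _ (by fun_prop) _ _ (by fun_prop)) ?_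
  filter_upwards [ae_restrict_mem measurableSet_Ioi] with v hv
  have hv' : 0 < v := hv
  rw [norm_mul, norm_cpow_eq_rpow_re_of_pos hv, norm_div, norm_exp]
  have e1 : (-(v : ℂ) ^ 2 / (4 * Real.pi)).re = -v ^ 2 / (4 * Real.pi) := by
    have : (-(v : ℂ) ^ 2 / (4 * Real.pi)) = ((-v ^ 2 / (4 * Real.pi) : ℝ) : ℂ) := by push_cast; ring
    rw [this, ofReal_re]
  rw [e1]
  have e : v ^ ((s - 1).re) = v ^ (s.re - 1 - 1) * v := by
    rw [← Real.rpow_add_one hv'.ne']; simp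
  rw [e]
  have hY := Y_ge hv'
  have hE : Real.exp (-v ^ 2 / (4 * Real.pi)) ≤ Real.exp Real.pi * Real.exp (-1 * v) := by
    rw [← Real.exp_add]
    refine Real.exp_le_exp.2 ?_
    rw [div_le_iff₀ (by positivity)]
    nlinarith [sq_nonneg (v - 2 * Real.pi)]
  calc _ ≤ v ^ (s.re - 1 - 1) * v * ((Real.exp Real.pi * Real.exp (-1 * v)) / (2 * hh * v)) := by
        gcongr
    _ = _ := by field_simp

lemma om_cpow (s : ℂ) (n : ℕ) : (((n : ℂ) + 1) * om) ^ (-s) = cexp (-(Real.pi * I / 4 * s)) * (1 / ((n : ℂ) + 1) ^ s) := by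
  have hn : (0 : ℝ) < n + 1 := by positivity
  have e : ((n : ℂ) + 1) = ((n + 1 : ℝ) : ℂ) := by push_cast; ring
  have hne : ((n + 1 : ℝ) : ℂ) ≠ 0 := by exact_mod_cast hn.ne'
  have hlog : log om = Real.pi * I / 4 := by
    unfold om
    have : (Real.pi * I / 4 : ℂ) = ((Real.pi / 4 : ℝ) : ℂ) * I := by push_cast; ring
    rw [this, log_exp]
    · simp; linarith [Real.pi_pos]
    · simp; linarith [Real.pi_pos]
  rw [e, one_div, ← cpow_neg, cpow_def_of_ne_zero (mul_ne_zero hne om_ne), cpow_def_of_ne_zero hne,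
    log_ofReal_mul hn om_ne, hlog, ← exp_add, ← ofReal_log hn.le]
  congr 1; ring

lemma zeta_int {s : ℂ} (hs : 1 < s.re) :
    ∫ v in Ioi (0 : ℝ), (v : ℂ) ^ (s - 1) * (1 / (cexp (om * v) - 1)) =
      cexp (-(Real.pi * I / 4 * s)) * (Gamma s * riemannZeta s) := by
  have hp := hh_pos
  have hs0 : 0 < s.re := by linarith
  have hre : ∀ n : ℕ, 0 < (((n : ℂ) + 1) * om).re := by
    intro n
    have : (((n : ℂ) + 1) * om) = ((n + 1 : ℝ) : ℂ) * om := by push_cast; ring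
    rw [this, re_ofReal_mul, om_re]; positivity
  have hsum := hasSum_integral_of_summable_integral_norm (μ := volume.restrict (Ioi (0 : ℝ)))
    (F := fun (n : ℕ) (v : ℝ) => (v : ℂ) ^ (s - 1) * cexp (-(((n : ℂ) + 1) * om * v)))
    (fun n => mintC hs0 (hre n)) (by
      have : ∀ n : ℕ, ∫ v in Ioi (0 : ℝ), ‖(v : ℂ) ^ (s - 1) * cexp (-(((n : ℂ) + 1) * om * v))‖ =
          (1 / (2 * hh)) ^ s.re * Real.Gamma s.re * (1 / ((n + 1 : ℕ) : ℝ) ^ s.re) := by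
        intro n
        have hn : (0 : ℝ) < n + 1 := by positivity
        have h := Real.integral_rpow_mul_exp_neg_mul_Ioi hs0 (r := (n + 1) * (2 * hh)) (by positivity)
        rw [Real.div_rpow zero_le_one (by positivity), Real.mul_rpow (by positivity) (by positivity)] at h
        rw [Real.div_rpow zero_le_one (by positivity)]
        push_cast
        have h' : (1 : ℝ) ^ s.re / (2 * hh) ^ s.re * Real.Gamma s.re * (1 / ((n : ℝ) + 1) ^ s.re) =
          1 ^ s.re / (((n : ℝ) + 1) ^ s.re * (2 * hh) ^ s.re) * Real.Gamma s.re := by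
          field_simp
        rw [h', ← h]
        refine setIntegral_congr_fun measurableSet_Ioi fun v hv => ?_
        have hv' : 0 < v := hv
        rw [norm_mul, norm_cpow_eq_rpow_re_of_pos hv', norm_exp]
        have e2 : (-(((n : ℂ) + 1) * om * v)).re = -((n + 1) * (2 * hh) * v) := by
          have : (-(((n : ℂ) + 1) * om * v)) = ((-((n + 1) * v) : ℝ) : ℂ) * om := by push_cast; ring
          rw [this, re_ofReal_mul, om_re]; ring
        rw [e2]; simp
      simp_rw [this]
      refine Summable.mul_left _ ?_
      exact (summable_nat_add_iff 1).2 (Real.summable_one_div_nat_rpow.2 hs))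
  have e1 : ∫ v in Ioi (0 : ℝ), (v : ℂ) ^ (s - 1) * (1 / (cexp (om * v) - 1)) =
      ∫ v in Ioi (0 : ℝ), ∑' n : ℕ, (v : ℂ) ^ (s - 1) * cexp (-(((n : ℂ) + 1) * om * v)) := by
    refine setIntegral_congr_fun measurableSet_Ioi fun v hv => ?_
    have hv' : 0 < v := hv
    rw [tsum_mul_left]
    congr 1
    have hnorm : ‖cexp (-(om * v))‖ < 1 := by
      rw [norm_exp]
      have : (-(om * v)).re = - (2 * hh * v) := by rw [neg_re, re_mul_ofReal, om_re]
      rw [this, Real.exp_lt_one_iff]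
      have : 0 < 2 * hh * v := by positivity
      linarith
    have e2 : ∀ n : ℕ, cexp (-(((n : ℂ) + 1) * om * v)) = cexp (-(om * v)) * cexp (-(om * v)) ^ n := by
      intro n
      rw [← exp_nat_mul, ← exp_add]; congr 1; ring
    simp_rw [e2]
    rw [tsum_mul_left, tsum_geometric_of_norm_lt_one hnorm, exp_neg]
    have h1 := X_ne hv'
    have h2 := exp_ne_zero (om * v)
    have h3 : (1 - (cexp (om * v))⁻¹) = (cexp (om * v) - 1) / cexp (om * v) := by field_simp
    rw [h3]; field_simp
  rw [e1, ← hsum.tsum_eq, zeta_eq_tsum_one_div_nat_add_one_cpow hs, ← tsum_mul_left, ← tsum_mul_left]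
  congr 1; ext n
  rw [gamC hs0 (hre n), om_cpow]; ring

/-- first form of the Riemann-Siegel formula -/
lemma RS1 {s : ℂ} (hs : 1 < s.re) : Gamma s * RiemannR s = Gamma s * riemannZeta s -
    cexp (Real.pi * I / 4 * s) *
      ∫ v in Ioi (0 : ℝ), (v : ℂ) ^ (s - 1) * (cexp (-v ^ 2 / (4 * Real.pi)) / (cexp (om * v / 2) - cexp (-(om * v / 2)))) := by
  rw [GR (by linarith)]
  have : -om * cexp (Real.pi * I / 4 * s) * ∫ v in Ioi (0 : ℝ), (v : ℂ) ^ (s - 1) * Psi hh v =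
      cexp (Real.pi * I / 4 * s) * ((∫ v in Ioi (0 : ℝ), (v : ℂ) ^ (s - 1) * (1 / (cexp (om * v) - 1))) -
        ∫ v in Ioi (0 : ℝ), (v : ℂ) ^ (s - 1) * (cexp (-v ^ 2 / (4 * Real.pi)) / (cexp (om * v / 2) - cexp (-(om * v / 2))))) := by
    rw [← integral_sub (int1 hs) (int2 hs), mul_comm (-om), mul_assoc, ← integral_const_mul]
    congr 1
    refine setIntegral_congr_fun measurableSet_Ioi fun v hv => ?_
    have := Psi_eq (v := v) hv
    rw [← mul_sub, ← this]; ring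
  rw [this, zeta_int hs, mul_sub, ← mul_assoc, ← exp_add, add_neg_cancel, exp_zero, one_mul]


lemma E_facts : ∃ E : ℂ → ℂ, Differentiable ℂ E ∧ (∀ z, z ≠ 0 → D z = z * E z) ∧
    (∀ z : ℂ, |z.im| ≤ hh → E z ≠ 0) := by
  have hpi : (Real.pi : ℂ) ≠ 0 := by exact_mod_cast Real.pi_ne_zero
  have hD0 : D 0 = 0 := by simp [D]
  have hE0 : dslope D 0 0 = -2 * Real.pi * I * om := by
    rw [dslope_same]
    have : HasDerivAt D (cexp (-(Real.pi * I * om * 0)) * (-(Real.pi * I * om * 1)) - cexp (Real.pi * I * om * 0) * (Real.pi * I * om * 1)) 0 :=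
      ((((hasDerivAt_id (0:ℂ)).const_mul (Real.pi * I * om)).neg).cexp).sub (((hasDerivAt_id (0:ℂ)).const_mul (Real.pi * I * om)).cexp)
    rw [this.deriv]; simp; ring
  have hEz : ∀ z, z ≠ 0 → D z = z * dslope D 0 z := by
    intro z hz
    rw [dslope_of_ne _ hz, slope_def_field, hD0, sub_zero, sub_zero, mul_div_cancel₀ _ hz]
  refine ⟨dslope D 0, ?_, hEz, ?_⟩
  · rw [← differentiableOn_univ, Complex.differentiableOn_dslope univ_mem]
    exact D_diff.differentiableOn
  · intro z hz
    by_cases h0 : z = 0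
    · rw [h0, hE0]; simp [hpi, om_ne]
    · intro h
      exact D_ne z hz h0 (by rw [hEz z h0, h, mul_zero])

lemma slit_aux {z : ℂ} (hz : 0 ≤ z.im) (h0 : z ≠ 0) : -I * z ∈ slitPlane := by
  rw [mem_slitPlane_iff]
  by_cases h : 0 < z.im
  · left; simpa using h
  · right
    have him : z.im = 0 := le_antisymm (not_lt.1 h) hz
    intro h'
    apply h0
    apply Complex.ext
    · simpa using h'
    · simpa using him

lemma W_cont {q : ℂ} (hq : 2 < q.re) : ContinuousOn (W (1 - q)) {z | z.im ∈ Icc 0 hh} := by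
  obtain ⟨E, hEd, hEz, hEne⟩ := E_facts
  have hre : 0 < (q - 2).re := by simp; linarith
  have hne : q - 2 ≠ 0 := by intro h; rw [h] at hre; simp at hre
  have hne1 : q - 1 ≠ 0 := by intro h; have := congrArg re h; simp at this; linarith
  have e : EqOn (W (1 - q)) (fun z => (-I * z) ^ (q - 2) * (-I * cexp (-Real.pi * z ^ 2) / E z)) {z | z.im ∈ Icc 0 hh} := by
    intro z hz
    have hz' : z.im ∈ Icc 0 hh := hz
    have hEn := hEne z (by rw [abs_of_nonneg hz'.1]; exact hz'.2)
    unfold W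
    rw [neg_sub]
    by_cases h0 : z = 0
    · simp [h0, hne, hne1]
    · have hIz : -I * z ≠ 0 := by simp [h0]
      have : q - 1 = (q - 2) + 1 := by ring
      dsimp only
      rw [this, cpow_add _ _ hIz, cpow_one, hEz z h0]
      field_simp
  refine ContinuousOn.congr ?_ e
  intro z hz
  have hz' : z.im ∈ Icc 0 hh := hz
  have hEn := hEne z (by rw [abs_of_nonneg hz'.1]; exact hz'.2)
  refine ContinuousAt.continuousWithinAt (ContinuousAt.mul ?_ ?_)
  · have hlin : ContinuousAt (fun z : ℂ => -I * z) z := by fun_prop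
    by_cases h0 : z = 0
    · have h1 := continuousAt_cpow_zero_of_re_pos hre
      have h2 : ContinuousAt (fun w : ℂ => w ^ (q - 2)) (-I * z) := by
        rw [h0, mul_zero]
        exact ContinuousAt.comp (f := fun w : ℂ => (w, q - 2)) (g := fun x : ℂ × ℂ => x.1 ^ x.2) h1 (by fun_prop)
      exact ContinuousAt.comp (f := fun z : ℂ => -I * z) h2 hlin
    · exact hlin.cpow continuousAt_const (slit_aux hz'.1 h0)
  · exact ContinuousAt.div (by fun_prop) (hEd z).continuousAt hEn

lemma W_diff (q : ℂ) : DifferentiableOn ℂ (W (1 - q)) {z | z.im ∈ Ioo 0 hh} := by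
  intro z hz
  have hz' : z.im ∈ Ioo 0 hh := hz
  have h0 : z ≠ 0 := by rintro rfl; simp at hz'
  refine DifferentiableAt.differentiableWithinAt (DifferentiableAt.mul ?_ ?_)
  · exact DifferentiableAt.cpow (by fun_prop) (by fun_prop) (slit_aux hz'.1.le h0)
  · exact DifferentiableAt.div (by fun_prop) (D_diff z) (D_ne z (by rw [abs_of_pos hz'.1]; exact hz'.2.le) h0)

lemma W_bound {q : ℂ} (hq : 2 < q.re) (x y : ℝ) (hy : y ∈ Icc 0 hh) (hx : 1 ≤ |x|) :
    ‖W (1 - q) (x + y * I)‖ ≤ Real.exp (Real.pi * |q.im|) * Real.exp Real.pi *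
      Real.exp (-Real.pi * |x| ^ 2 + (q.re - 1) * |(|x|)|) := by
  have hD := D_ge_far x y (by rw [abs_of_nonneg hy.1]; exact hy.2) hx
  have hh1 := hh_lt
  have hn : ‖(x : ℂ) + y * I‖ ≤ Real.exp |x| := by
    have h1 := norm_le_abs_re_add_abs_im ((x : ℂ) + y * I)
    simp [abs_of_nonneg hy.1] at h1
    have := Real.add_one_le_exp |x|
    linarith [hy.2]
  unfold W
  rw [neg_sub, norm_mul, norm_div, norm_gauss]
  have hA : ‖(-I * ((x : ℂ) + y * I)) ^ (q - 1)‖ ≤ Real.exp (Real.pi * |q.im|) * Real.exp ((q.re - 1) * |x|) := by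
    refine (norm_cpow_le _ _).trans ?_
    rw [norm_mul, norm_neg, norm_I, one_mul, div_eq_mul_inv, ← Real.exp_neg, mul_comm]
    refine mul_le_mul (Real.exp_le_exp.2 ?_) ?_ (by positivity) (by positivity)
    · refine (neg_le_abs _).trans ?_
      rw [abs_mul]
      simp only [sub_im, one_im, sub_zero]
      exact mul_le_mul_of_nonneg_right (abs_arg_le_pi _) (abs_nonneg _)
    · rw [mul_comm (q.re - 1), Real.exp_mul, sub_re, one_re]
      exact Real.rpow_le_rpow (norm_nonneg _) hn (by linarith)
  have hB : Real.exp (-Real.pi * x ^ 2 + Real.pi * y ^ 2) / ‖D (x + y * I)‖ ≤ Real.exp Real.pi * Real.exp (-Real.pi * x ^ 2) := by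
    refine (div_le_self (Real.exp_pos _).le hD).trans ?_
    rw [← Real.exp_add]
    refine Real.exp_le_exp.2 ?_
    have : y ^ 2 ≤ 1 := by nlinarith [hy.1, hy.2]
    nlinarith [Real.pi_pos]
  refine (mul_le_mul hA hB (by positivity) (by positivity)).trans (le_of_eq ?_)
  rw [abs_abs, sq_abs, Real.exp_add]; ring

lemma W_int {q : ℂ} (hq : 2 < q.re) (y : ℝ) (hy : y ∈ Icc 0 hh) :
    Integrable (fun x : ℝ => W (1 - q) (x + y * I)) := by
  have hc : Continuous (fun x : ℝ => W (1 - q) (x + y * I)) := by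
    rw [← continuousOn_univ]
    refine (W_cont hq).comp (by fun_prop) fun x _ => ?_
    simpa using hy
  rw [← integrableOn_univ, ← union_compl_self (Icc (-1 : ℝ) 1)]
  refine (hc.continuousOn.integrableOn_compact isCompact_Icc).union ?_
  refine (((gint (q.re - 1)).const_mul (Real.exp (Real.pi * |q.im|) * Real.exp Real.pi)).integrableOn).mono'
    hc.aestronglyMeasurable ?_
  filter_upwards [ae_restrict_mem measurableSet_Icc.compl] with x hx
  have h1 : 1 ≤ |x| := by
    by_contra h
    exact hx (abs_le.1 (not_le.1 h).le)
  have := W_bound hq x y hy h1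
  rwa [abs_abs, sq_abs] at this

lemma W_shift {q : ℂ} (hq : 2 < q.re) : ∫ u : ℝ, W (1 - q) (u + hh * I) = ∫ u : ℝ, W (1 - q) u := by
  have hp := hh_pos
  have h := strip (W (1 - q)) 0 hh hp.le (W_cont hq) (W_diff q)
    (fun t => Real.exp (Real.pi * |q.im|) * Real.exp Real.pi * Real.exp (-Real.pi * t ^ 2 + (q.re - 1) * |t|)) (by
    simpa using (gtend (q.re - 1)).const_mul (Real.exp (Real.pi * |q.im|) * Real.exp Real.pi)) (W_bound hq)
  have i0 := W_int hq 0 ⟨le_rfl, hp.le⟩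
  have i1 := W_int hq hh ⟨hp.le, le_rfl⟩
  have h0 := (intervalIntegral_tendsto_integral i0 tendsto_neg_atTop_atBot tendsto_id).sub
    (intervalIntegral_tendsto_integral i1 tendsto_neg_atTop_atBot tendsto_id)
  have := tendsto_nhds_unique h0 h
  simp only [ofReal_zero, zero_mul, add_zero] at this
  exact (sub_eq_zero.1 this).symm

noncomputable def K (q : ℂ) : ℂ := ∫ u in Ioi (0 : ℝ), (u : ℂ) ^ (q - 1) * P u

lemma W_line {q : ℂ} (hq : 2 < q.re) : ∫ u : ℝ, W (1 - q) u = 2 * I * Complex.cos (Real.pi * q / 2) * K q := by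
  have hp := hh_pos
  have i0 := W_int hq 0 ⟨le_rfl, hp.le⟩
  simp only [ofReal_zero, zero_mul, add_zero] at i0
  rw [← intervalIntegral.integral_Iic_add_Ioi (b := 0) i0.integrableOn i0.integrableOn]
  have h1 := integral_comp_neg_Ioi (c := 0) (f := fun u : ℝ => W (1 - q) u)
  rw [neg_zero] at h1
  rw [← h1, ← integral_add, K, ← integral_const_mul]
  · refine setIntegral_congr_fun measurableSet_Ioi fun u hu => ?_
    have hu' : 0 < u := hu
    have hu0 : (u : ℂ) ≠ 0 := by exact_mod_cast hu'.ne'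
    have c1 : (-I * (u : ℂ)) ^ (q - 1) = cexp (-(Real.pi / 2 * I) * (q - 1)) * (u : ℂ) ^ (q - 1) := by
      rw [cpow_def_of_ne_zero (by simp [hu0]), cpow_def_of_ne_zero hu0, mul_comm (-I), log_ofReal_mul hu' (by simp), log_neg_I, ← exp_add, ofReal_log hu'.le]
      congr 1; ring
    have c2 : (I * (u : ℂ)) ^ (q - 1) = cexp ((Real.pi / 2 * I) * (q - 1)) * (u : ℂ) ^ (q - 1) := by
      rw [cpow_def_of_ne_zero (by simp [hu0]), cpow_def_of_ne_zero hu0, mul_comm I, log_ofReal_mul hu' (by simp), log_I, ← exp_add, ofReal_log hu'.le]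
      congr 1; ring
    have c3 : cexp (-(Real.pi / 2 * I) * (q - 1)) - cexp ((Real.pi / 2 * I) * (q - 1)) = 2 * I * Complex.cos (Real.pi * q / 2) := by
      have a1 : -(Real.pi / 2 * I) * (q - 1) = -(Real.pi * q / 2) * I + Real.pi / 2 * I := by ring
      have a2 : (Real.pi / 2 * I) * (q - 1) = (Real.pi * q / 2) * I + -(Real.pi / 2 * I) := by ring
      rw [a1, a2, exp_add, exp_add, exp_neg (Real.pi / 2 * I), exp_pi_div_two_mul_I, inv_I, Complex.cos]
      ring
    unfold W P
    rw [neg_sub, ofReal_neg, D_neg, neg_sq, neg_mul_neg, c1, c2, ← c3]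
    ring
  · exact (i0.comp_neg).integrableOn
  · exact i0.integrableOn

lemma conj_K (s : ℂ) : (starRingEnd ℂ) (K ((starRingEnd ℂ) s)) =
    ∫ u in Ioi (0 : ℝ), (u : ℂ) ^ (s - 1) * (cexp (-Real.pi * u ^ 2) / (cexp (Real.pi * om * u) - cexp (-(Real.pi * om * u)))) := by
  unfold K
  rw [← integral_conj]
  refine setIntegral_congr_fun measurableSet_Ioi fun u hu => ?_
  have hu' : 0 < u := hu
  have c1 : (starRingEnd ℂ) ((u : ℂ) ^ ((starRingEnd ℂ) s - 1)) = (u : ℂ) ^ (s - 1) := by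
    have hsc : (starRingEnd ℂ) s - 1 = (starRingEnd ℂ) (s - 1) := by simp
    rw [hsc, cpow_conj _ _ (by rw [arg_ofReal_of_nonneg hu'.le]; exact Real.pi_ne_zero.symm)]
    simp
  have c2 : (starRingEnd ℂ) (Real.pi * I * om * u) = -(Real.pi * om * u) := by
    simp only [map_mul, conj_om, conj_I, conj_ofReal]
    linear_combination (Real.pi * om * u) * I_sq
  rw [map_mul, c1]
  unfold P D
  rw [map_div₀, map_sub, ← exp_conj, ← exp_conj, ← exp_conj, map_neg, c2, neg_neg]
  simp only [map_mul, map_neg, map_pow, conj_ofReal]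

lemma J_eq (s : ℂ) : ∫ v in Ioi (0 : ℝ), (v : ℂ) ^ (s - 1) * (cexp (-v ^ 2 / (4 * Real.pi)) / (cexp (om * v / 2) - cexp (-(om * v / 2))))
    = (2 * Real.pi : ℂ) ^ s * (starRingEnd ℂ) (K ((starRingEnd ℂ) s)) := by
  have hpi : (Real.pi : ℂ) ≠ 0 := by exact_mod_cast Real.pi_ne_zero
  have h2 : (2 * Real.pi : ℂ) ≠ 0 := by simp [hpi]
  have h := integral_comp_mul_left_Ioi (fun v : ℝ => (v : ℂ) ^ (s - 1) * (cexp (-v ^ 2 / (4 * Real.pi)) / (cexp (om * v / 2) - cexp (-(om * v / 2))))) 0 (b := 2 * Real.pi) (by positivity)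
  rw [mul_zero] at h
  have e : ∫ x in Ioi (0 : ℝ), (((2 * Real.pi * x : ℝ) : ℂ)) ^ (s - 1) * (cexp (-((2 * Real.pi * x : ℝ) : ℂ) ^ 2 / (4 * Real.pi)) / (cexp (om * ((2 * Real.pi * x : ℝ) : ℂ) / 2) - cexp (-(om * ((2 * Real.pi * x : ℝ) : ℂ) / 2))))
      = (2 * Real.pi : ℂ) ^ (s - 1) * (starRingEnd ℂ) (K ((starRingEnd ℂ) s)) := by
    rw [conj_K, ← integral_const_mul]
    refine setIntegral_congr_fun measurableSet_Ioi fun u hu => ?_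
    have hu' : 0 < u := hu
    rw [ofReal_mul (2 * Real.pi), mul_cpow_ofReal_nonneg (by positivity) hu'.le]
    have a1 : -(((2 * Real.pi : ℝ) : ℂ) * u) ^ 2 / (4 * Real.pi) = -Real.pi * u ^ 2 := by
      push_cast; field_simp; ring
    have a2 : om * (((2 * Real.pi : ℝ) : ℂ) * u) / 2 = Real.pi * om * u := by push_cast; ring
    rw [a1, a2]; push_cast; ring
  rw [e, cpow_sub _ _ h2, cpow_one] at h
  rw [div_mul_eq_mul_div, div_eq_iff h2] at h
  rw [h, real_smul]
  generalize (∫ v in Ioi (0 : ℝ), (v : ℂ) ^ (s - 1) * (cexp (-v ^ 2 / (4 * Real.pi)) / (cexp (om * v / 2) - cexp (-(om * v / 2))))) = J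
  push_cast
  field_simp

lemma main_ge {s : ℂ} (hs : 2 < s.re) :
    (2 * Real.pi : ℂ) ^ s * (starRingEnd ℂ) (RiemannR (1 - (starRingEnd ℂ) s)) =
      2 * Complex.cos (Real.pi * s / 2) * (Gamma s * (riemannZeta s - RiemannR s)) := by
  have h1 := RS1 (s := s) (by linarith)
  rw [J_eq] at h1
  have h2 := R_eq (1 - (starRingEnd ℂ) s)
  rw [W_shift (by simpa using hs), W_line (by simpa using hs)] at h2
  have h3 : (starRingEnd ℂ) (RiemannR (1 - (starRingEnd ℂ) s)) =
      2 * cexp (Real.pi * I / 4 * s) * Complex.cos (Real.pi * s / 2) * (starRingEnd ℂ) (K ((starRingEnd ℂ) s)) := by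
    rw [h2]
    have a1 : (starRingEnd ℂ) (cexp (Real.pi * I / 4 * (1 - (starRingEnd ℂ) s))) = (-I * om) * cexp (Real.pi * I / 4 * s) := by
      rw [← conj_om, om, ← exp_conj, ← exp_conj, ← exp_add]
      congr 1
      simp only [map_div₀, map_mul, map_sub, map_one, conj_I, conj_ofReal, map_ofNat, conj_conj]
      ring
    have a2 : (starRingEnd ℂ) (Complex.cos (Real.pi * (starRingEnd ℂ) s / 2)) = Complex.cos (Real.pi * s / 2) := by
      rw [← cos_conj]
      congr 1
      simp only [map_div₀, map_mul, conj_ofReal, map_ofNat, conj_conj]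
    simp only [map_mul, map_neg, a1, a2, conj_om, conj_I, map_ofNat]
    linear_combination (2 * I ^ 3 * cexp (Real.pi * I / 4 * s) * Complex.cos (Real.pi * s / 2) * (starRingEnd ℂ) (K ((starRingEnd ℂ) s))) * om_sq
      + (2 * (I ^ 2 - 1) * cexp (Real.pi * I / 4 * s) * Complex.cos (Real.pi * s / 2) * (starRingEnd ℂ) (K ((starRingEnd ℂ) s))) * I_sq
  rw [h3]
  linear_combination (2 * Complex.cos (Real.pi * s / 2)) * h1

lemma log_bound (u : ℝ) : ‖log (-I * (u + hh * I))‖ ≤ |u| + 10 := by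
  have hp := hh_pos
  set w : ℂ := -I * (u + hh * I) with hw
  have hn : ‖w‖ = ‖(u : ℂ) + hh * I‖ := by rw [hw, norm_mul, norm_neg, norm_I, one_mul]
  have h1 : ‖w‖ ≤ |u| + 1 := by
    have h1 := norm_le_abs_re_add_abs_im ((u : ℂ) + hh * I)
    simp [abs_of_pos hp] at h1
    rw [hn]; linarith [hh_lt]
  have h2 : 1 / 3 ≤ ‖w‖ := by
    have h1 := abs_im_le_norm ((u : ℂ) + hh * I)
    simp [abs_of_pos hp] at h1
    rw [hn]; linarith [hh_gt]
  have hpos : 0 < ‖w‖ := by linarith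
  have h3 : Real.log ‖w‖ ≤ |u| := by
    have := Real.log_le_sub_one_of_pos hpos; linarith
  have h4 : -2 ≤ Real.log ‖w‖ := by
    have := Real.one_sub_inv_le_log_of_pos hpos
    have h5 : ‖w‖⁻¹ ≤ 3 := by
      rw [inv_le_comm₀ hpos (by norm_num)]; linarith
    linarith
  refine (norm_le_abs_re_add_abs_im _).trans ?_
  rw [log_re, log_im]
  have h6 := abs_arg_le_pi w
  have h7 := Real.pi_lt_four
  have h8 : |Real.log ‖w‖| ≤ |u| + 2 := abs_le.2 ⟨by linarith [abs_nonneg u], by linarith⟩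
  linarith

lemma R_diff : Differentiable ℂ RiemannR := by
  have hp := hh_pos
  have hne : ∀ u : ℝ, -I * ((u : ℂ) + hh * I) ≠ 0 := by
    intro u h
    have := congrArg re h
    simp at this
    exact hp.ne' this
  have hW : ∀ s : ℂ, ∀ u : ℝ, W s (u + hh * I) = cexp (log (-I * (u + hh * I)) * (-s)) * P (u + hh * I) := by
    intro s u
    unfold W P
    rw [cpow_def_of_ne_zero (hne u)]
  have hlm : Measurable fun u : ℝ => log (-I * ((u : ℂ) + hh * I)) := by
    have := measurable_log
    fun_prop
  have hPm := P_meas hh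
  have hbd : ∀ (M : ℝ) (s : ℂ) (u : ℝ), ‖s‖ ≤ M → ‖cexp (log (-I * (u + hh * I)) * (-s))‖ ≤ Real.exp (M * (|u| + 10)) := by
    intro M s u hs
    rw [norm_exp]
    refine Real.exp_le_exp.2 ((re_le_norm _).trans ?_)
    rw [norm_mul, norm_neg, mul_comm]
    exact mul_le_mul hs (log_bound u) (norm_nonneg _) ((norm_nonneg _).trans hs)
  have hbound : ∀ M : ℝ, Integrable fun u : ℝ => Real.exp (M * (|u| + 10)) * (Real.exp (Real.pi) * Real.exp (-Real.pi * u ^ 2 + 0 * |u|)) := by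
    intro M
    refine ((gint M).const_mul (Real.exp (M * 10) * Real.exp Real.pi)).congr (ae_of_all _ fun u => ?_)
    dsimp only
    rw [← Real.exp_add, ← Real.exp_add, ← Real.exp_add, ← Real.exp_add]
    congr 1; ring
  have hintd : Differentiable ℂ fun s : ℂ => ∫ u : ℝ, W s (u + hh * I) := by
    intro s0
    simp_rw [hW]
    refine (hasDerivAt_integral_of_dominated_loc_of_deriv_le (μ := volume)
      (F := fun (s : ℂ) (u : ℝ) => cexp (log (-I * (u + hh * I)) * (-s)) * P (u + hh * I))
      (F' := fun (s : ℂ) (u : ℝ) => cexp (log (-I * (u + hh * I)) * (-s)) * (-log (-I * (u + hh * I))) * P (u + hh * I))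
      (bound := fun u : ℝ => Real.exp ((‖s0‖ + 2) * (|u| + 10)) * (Real.exp (Real.pi) * Real.exp (-Real.pi * u ^ 2 + 0 * |u|)))
      (s := Metric.ball s0 1)
      (Metric.ball_mem_nhds _ one_pos) ?_ ?_ ?_ ?_ (hbound _) ?_).2.differentiableAt
    · exact Eventually.of_forall fun s => Measurable.aestronglyMeasurable (by fun_prop)
    · refine (hbound ‖s0‖).mono' (Measurable.aestronglyMeasurable (by fun_prop)) (ae_of_all _ fun u => ?_)
      rw [norm_mul]
      exact mul_le_mul (hbd _ _ _ le_rfl) (P_le hh (Or.inl rfl) u) (norm_nonneg _) (Real.exp_pos _).le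
    · exact Measurable.aestronglyMeasurable (by fun_prop)
    · refine ae_of_all _ fun u s hs => ?_
      rw [norm_mul, norm_mul, norm_neg]
      have hs' : ‖s‖ ≤ ‖s0‖ + 1 := by
        rw [Metric.mem_ball, dist_eq_norm] at hs
        have := norm_sub_norm_le s s0
        linarith
      refine mul_le_mul ?_ (P_le hh (Or.inl rfl) u) (norm_nonneg _) (Real.exp_pos _).le
      have e : (‖s0‖ + 2) * (|u| + 10) = (‖s0‖ + 1) * (|u| + 10) + (|u| + 10) := by ring
      rw [e, Real.exp_add]
      refine mul_le_mul (hbd _ _ _ hs') ((log_bound u).trans ?_) (norm_nonneg _) (Real.exp_pos _).le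
      have := Real.add_one_le_exp (|u| + 10)
      linarith
    · refine ae_of_all _ fun u s _ => ?_
      refine HasDerivAt.mul_const ?_ _
      have : HasDerivAt (fun s : ℂ => log (-I * (u + hh * I)) * (-s)) (-log (-I * (u + hh * I))) s := by
        simpa using (hasDerivAt_neg s).const_mul (log (-I * (u + hh * I)))
      exact this.cexp
  have e : RiemannR = fun s => -om * cexp (Real.pi * I / 4 * s) * ∫ u : ℝ, W s (u + hh * I) := funext R_eq
  rw [e]
  exact Differentiable.mul (by fun_prop) hintd

lemma main_all {s : ℂ} (hs : s ≠ 1) :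
    (2 * Real.pi : ℂ) ^ s * (Gamma s)⁻¹ * (starRingEnd ℂ) (RiemannR (1 - (starRingEnd ℂ) s)) =
      2 * Complex.cos (Real.pi * s / 2) * (riemannZeta s - RiemannR s) := by
  have hpi : (Real.pi : ℂ) ≠ 0 := by exact_mod_cast Real.pi_ne_zero
  have h2 : (2 * Real.pi : ℂ) ≠ 0 := by simp [hpi]
  have hopen : IsOpen ({1}ᶜ : Set ℂ) := isOpen_compl_singleton
  have hconn : IsPreconnected ({1}ᶜ : Set ℂ) :=
    (isConnected_compl_singleton_of_one_lt_rank (by simp) 1).isPreconnected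
  have hcc : Differentiable ℂ fun s : ℂ => (starRingEnd ℂ) (RiemannR (1 - (starRingEnd ℂ) s)) := by
    intro s
    have hd : Differentiable ℂ fun z => RiemannR (1 - z) := R_diff.comp (by fun_prop)
    have := DifferentiableAt.conj_conj (hd ((starRingEnd ℂ) s))
    simpa [Function.comp_def] using this
  have hf : DifferentiableOn ℂ (fun s : ℂ => (2 * Real.pi : ℂ) ^ s * (Gamma s)⁻¹ * (starRingEnd ℂ) (RiemannR (1 - (starRingEnd ℂ) s))) {1}ᶜ := by
    refine Differentiable.differentiableOn ?_
    refine Differentiable.mul (Differentiable.mul ?_ differentiable_one_div_Gamma) hcc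
    exact fun s => DifferentiableAt.const_cpow differentiableAt_id (Or.inl h2)
  have hg : DifferentiableOn ℂ (fun s : ℂ => 2 * Complex.cos (Real.pi * s / 2) * (riemannZeta s - RiemannR s)) {1}ᶜ := by
    intro s hs
    refine DifferentiableAt.differentiableWithinAt ?_
    refine DifferentiableAt.mul (by fun_prop) ((differentiableAt_riemannZeta hs).sub (R_diff s))
  refine (hf.analyticOnNhd hopen).eqOn_of_preconnected_of_eventuallyEq (hg.analyticOnNhd hopen) hconn (z₀ := 3) (by norm_num) ?_ hs
  have : {s : ℂ | 2 < s.re} ∈ 𝓝 (3 : ℂ) := (isOpen_lt continuous_const continuous_re).mem_nhds (by norm_num)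
  filter_upwards [this] with s hs
  have hs' : 2 < s.re := hs
  have hG : Gamma s ≠ 0 := Gamma_ne_zero_of_re_pos (by linarith)
  have := main_ge hs'
  field_simp
  rw [this]; ring_nf

lemma key (t : ℝ) : Gammaℝ (1 / 2 + I * t) * riemannZeta (1 / 2 + I * t) =
    ((2 * (Gammaℝ (1 / 2 + I * t) * RiemannR (1 / 2 + I * t)).re : ℝ) : ℂ) := by
  set s : ℂ := 1 / 2 + I * t with hs
  have hre : s.re = 1 / 2 := by simp [hs]
  have hconj : (starRingEnd ℂ) s = 1 - s := by
    rw [hs]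
    simp only [map_add, map_mul, map_div₀, map_one, map_ofNat, conj_I, conj_ofReal]
    ring
  have hs1 : s ≠ 1 := by intro h; rw [h] at hre; norm_num at hre
  have hpi : (Real.pi : ℂ) ≠ 0 := by exact_mod_cast Real.pi_ne_zero
  have h2 : (2 * Real.pi : ℂ) ≠ 0 := by simp [hpi]
  have h := main_all hs1
  rw [hconj, sub_sub_cancel] at h
  have hG : Gamma s ≠ 0 := Gamma_ne_zero_of_re_pos (by rw [hre]; norm_num)
  have hGR : Gammaℝ (1 - s) ≠ 0 := Gammaℝ_ne_zero_of_re_pos (by rw [sub_re, hre]; norm_num)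
  have hq := Gammaℝ_div_Gammaℝ_one_sub (s := s) (by
    intro n hn
    rw [hn] at hre
    simp at hre
    have : (0 : ℝ) ≤ n := n.cast_nonneg
    linarith)
  rw [Gammaℂ_def, cpow_neg, div_eq_iff hGR] at hq
  have hGc : (starRingEnd ℂ) (Gammaℝ s) = Gammaℝ (1 - s) := by
    rw [← hconj, Gammaℝ_def, Gammaℝ_def, map_mul, ← Gamma_conj]
    have e1 : (starRingEnd ℂ) (s / 2) = (starRingEnd ℂ) s / 2 := by simp only [map_div₀, map_ofNat]
    have e2 : -(starRingEnd ℂ) s / 2 = (starRingEnd ℂ) (-s / 2) := by simp only [map_div₀, map_ofNat, map_neg]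
    rw [e1, e2, cpow_conj _ _ (by rw [arg_ofReal_of_nonneg Real.pi_pos.le]; exact Real.pi_ne_zero.symm), conj_ofReal]
  have hpow : (2 * Real.pi : ℂ) ^ s ≠ 0 := by rw [cpow_def_of_ne_zero h2]; exact exp_ne_zero _
  have hR : (starRingEnd ℂ) (RiemannR s) = 2 * ((2 * Real.pi : ℂ) ^ s)⁻¹ * Gamma s * Complex.cos (Real.pi * s / 2) * (riemannZeta s - RiemannR s) := by
    have : (starRingEnd ℂ) (RiemannR s) = ((2 * Real.pi : ℂ) ^ s)⁻¹ * Gamma s * ((2 * Real.pi : ℂ) ^ s * (Gamma s)⁻¹ * (starRingEnd ℂ) (RiemannR s)) := by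
      field_simp
    rw [this, h]; ring
  have hfin : (starRingEnd ℂ) (Gammaℝ s * RiemannR s) = Gammaℝ s * (riemannZeta s - RiemannR s) := by
    rw [map_mul, hGc, hR, hq]; ring
  have := add_conj (Gammaℝ s * RiemannR s)
  rw [hfin] at this
  rw [← this]; ring

end RSaux

/-- With `s = 1/2 + it`, one has `ζ(1/2 + it) = 0` iff
`Re (π^{−s/2} Γ(s/2) R(s)) = 0`. -/
theorem zeta_zero_iff_re_completed_R_zero (t : ℝ) :
    let s : ℂ := 1 / 2 + Complex.I * t
    riemannZeta s = 0 ↔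
      ((Real.pi : ℂ) ^ (-s / 2) * Complex.Gamma (s / 2) * RiemannR s).re = 0 := by
  intro s
  have h := RSaux.key t
  have hG : Complex.Gammaℝ s ≠ 0 := Complex.Gammaℝ_ne_zero_of_re_pos (by simp [s])
  change Complex.Gammaℝ s * riemannZeta s = ((2 * (Complex.Gammaℝ s * RiemannR s).re : ℝ) : ℂ) at h
  rw [← Complex.Gammaℝ_def]
  constructor
  · intro hz
    rw [hz, mul_zero] at h
    have h' : (2 * (Complex.Gammaℝ s * RiemannR s).re : ℝ) = 0 := by exact_mod_cast h.symm
    linarith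
  · intro hz
    rw [hz, mul_zero, Complex.ofReal_zero] at h
    exact (mul_eq_zero.1 h).resolve_left hG
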